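/- Let X be a compact metric space, f : X → X continuous, Φ : X → ℝ^m continuous, and suppose every w in the relative interior of Rot(Φ) is a convex combination of rotation vectors of periodic point measures (Φ is good). If the entropy map is affine and upper semi-continuous, then for every w ∈ ri(Rot(Φ)), the entropy spectrum satisfies h(M_Φ(w)) = [0, H(w)]. -/

import Mathlib

open MeasureTheory Topology Set
open scoped NNReal

/-- The set of `f`-invariant Borel probability measures. -/
def invMeasures {X : Type*} [MeasurableSpace X] (f : X → X) :
    Set (ProbabilityMeasure X) :=
  {μ | (μ : Measure X).map f = (μ : Measure X)}

/-- Periodic point measures: invariant measures equidistributed on a finite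
periodic orbit. -/
noncomputable def periodicMeasures {X : Type*} [MeasurableSpace X] (f : X → X) :
    Set (ProbabilityMeasure X) :=
  {μ | μ ∈ invMeasures f ∧ ∃ (x : X) (n : ℕ), 0 < n ∧ f^[n] x = x ∧
    (μ : Measure X) = (n : ℝ≥0)⁻¹ • ∑ i ∈ Finset.range n, Measure.dirac (f^[i] x)}

/-- Rotation vector of a measure with respect to `Φ = (φ₁, …, φ_m)`. -/
noncomputable def rv {X : Type*} [MeasurableSpace X] {m : ℕ}
    (Φ : Fin m → X → ℝ) (μ : ProbabilityMeasure X) : Fin m → ℝ :=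
  fun i => ∫ x, Φ i x ∂(μ : Measure X)

/-- The rotation set of `Φ`. -/
noncomputable def rotSet {X : Type*} [MeasurableSpace X] {m : ℕ}
    (f : X → X) (Φ : Fin m → X → ℝ) : Set (Fin m → ℝ) :=
  rv Φ '' invMeasures f

/-- The rotation class of a rotation vector `w`. -/
noncomputable def rotClass {X : Type*} [MeasurableSpace X] {m : ℕ}
    (f : X → X) (Φ : Fin m → X → ℝ) (w : Fin m → ℝ) : Set (ProbabilityMeasure X) :=
  {μ ∈ invMeasures f | rv Φ μ = w}

theorem aux_mix {X : Type*} [MetricSpace X] [CompactSpace X] [MeasurableSpace X] [BorelSpace X]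
    (f : X → X) (hf : Continuous f) {m : ℕ}
    (Φ : Fin m → X → ℝ) (hΦ : ∀ i, Continuous (Φ i))
    (μ ν : ProbabilityMeasure X) (hμ : μ ∈ invMeasures f) (hν : ν ∈ invMeasures f)
    (t : ℝ≥0) (ht : t ≤ 1) :
    ∃ ξ : ProbabilityMeasure X, ξ ∈ invMeasures f ∧
      (ξ : Measure X) = t • (μ : Measure X) + (1 - t) • (ν : Measure X) ∧
      rv Φ ξ = (t : ℝ) • rv Φ μ + ((1 : ℝ) - (t : ℝ)) • rv Φ ν := by
  have hint : ∀ (i : Fin m) (κ : Measure X) [IsFiniteMeasure κ], Integrable (Φ i) κ := by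
    intro i κ _
    exact (hΦ i).integrable_of_hasCompactSupport (HasCompactSupport.of_compactSpace _)
  have hp : IsProbabilityMeasure (t • (μ : Measure X) + (1 - t) • (ν : Measure X)) := by
    constructor
    simp only [Measure.add_apply, Measure.smul_apply, measure_univ]
    rw [← add_smul, add_tsub_cancel_of_le ht, one_smul]
  refine ⟨⟨_, hp⟩, ?_, rfl, ?_⟩
  · change Measure.map f (t • (μ : Measure X) + (1 - t) • (ν : Measure X)) = _
    rw [Measure.map_add _ _ hf.measurable, Measure.map_smul, Measure.map_smul,
      show Measure.map f (μ : Measure X) = μ from hμ,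
      show Measure.map f (ν : Measure X) = ν from hν]
    rfl
  · funext i
    change ∫ x, Φ i x ∂(t • (μ : Measure X) + (1 - t) • (ν : Measure X)) = _
    rw [integral_add_measure (hint i _) (hint i _), integral_smul_nnreal_measure,
      integral_smul_nnreal_measure]
    simp [rv, NNReal.smul_def, NNReal.coe_sub ht]

theorem aux_compact {X : Type*} [MetricSpace X] [CompactSpace X] [MeasurableSpace X]
    [BorelSpace X] (f : X → X) (hf : Continuous f) {m : ℕ}
    (Φ : Fin m → X → ℝ) (hΦ : ∀ i, Continuous (Φ i)) (w : Fin m → ℝ) :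
    IsCompact (rotClass f Φ w) := by
  have h1 : IsClosed (invMeasures f) := by
    have : invMeasures f = {μ : ProbabilityMeasure X |
        μ.map hf.measurable.aemeasurable = μ} := by
      ext μ
      simp only [invMeasures, mem_setOf_eq]
      constructor
      · intro h
        exact ProbabilityMeasure.toMeasure_injective h
      · intro h
        exact congrArg ProbabilityMeasure.toMeasure h
    rw [this]
    exact isClosed_eq (ProbabilityMeasure.continuous_map hf) continuous_id
  have h2 : Continuous (rv Φ) := by
    refine continuous_pi fun i => ?_
    exact ProbabilityMeasure.continuous_integral_continuousMap (⟨Φ i, hΦ i⟩ : C(X, ℝ))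
  exact (h1.inter (isClosed_eq h2 continuous_const)).isCompact

/-- For a good potential and an affine, upper semi-continuous entropy map that
vanishes on periodic point measures, the entropy spectrum of every rotation
vector in the relative interior of the rotation set equals `[0, H(w)]`. -/
theorem entropy_spectrum_relint_good
    {X : Type*} [MetricSpace X] [CompactSpace X] [MeasurableSpace X] [BorelSpace X]
    (f : X → X) (hf : Continuous f) {m : ℕ}
    (Φ : Fin m → X → ℝ) (hΦ : ∀ i, Continuous (Φ i))
    (hgood : ∀ w ∈ intrinsicInterior ℝ (rotSet f Φ),
      w ∈ convexHull ℝ (rv Φ '' periodicMeasures f))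
    (h : ProbabilityMeasure X → ℝ) (h0 : ∀ μ, 0 ≤ h μ)
    (husc : UpperSemicontinuousOn h (invMeasures f))
    (haff : ∀ μ ∈ invMeasures f, ∀ ν ∈ invMeasures f, ∀ t : ℝ≥0, t ≤ 1 →
      ∀ ξ : ProbabilityMeasure X,
        (ξ : Measure X) = t • (μ : Measure X) + (1 - t) • (ν : Measure X) →
        h ξ = (t : ℝ) * h μ + ((1 : ℝ) - (t : ℝ)) * h ν)
    (hper : ∀ μ ∈ periodicMeasures f, h μ = 0) :
    ∀ w ∈ intrinsicInterior ℝ (rotSet f Φ),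
      h '' rotClass f Φ w = Icc 0 (sSup (h '' rotClass f Φ w)) := by
  intro w hw
  have hzero : ∃ μ ∈ rotClass f Φ w, h μ = 0 := by
    have hconv : Convex ℝ (rv Φ '' {μ | μ ∈ invMeasures f ∧ h μ = 0}) := by
      rintro _ ⟨μ, ⟨hμ, hμ0⟩, rfl⟩ _ ⟨ν, ⟨hν, hν0⟩, rfl⟩ a b ha hb hab
      lift a to ℝ≥0 using ha
      have hb' : b = 1 - (a : ℝ) := by linarith
      have ha1 : a ≤ 1 := by
        rw [← NNReal.coe_le_coe, NNReal.coe_one]; linarith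
      obtain ⟨ξ, hξ, hξm, hξr⟩ := aux_mix f hf Φ hΦ μ ν hμ hν a ha1
      refine ⟨ξ, ⟨hξ, ?_⟩, ?_⟩
      · rw [haff μ hμ ν hν a ha1 ξ hξm, hμ0, hν0]; simp
      · rw [hξr, hb']
    have hsub : rv Φ '' periodicMeasures f ⊆ rv Φ '' {μ | μ ∈ invMeasures f ∧ h μ = 0} :=
      image_mono fun μ hμ => ⟨hμ.1, hper μ hμ⟩
    obtain ⟨μ, ⟨hμ, hμ0⟩, hμw⟩ := convexHull_min hsub hconv (hgood w hw)
    exact ⟨μ, ⟨hμ, hμw⟩, hμ0⟩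
  obtain ⟨ν, hν, hν0⟩ := hzero
  obtain ⟨μ, hμ, hmax⟩ := UpperSemicontinuousOn.exists_isMaxOn ⟨ν, hν⟩
    (aux_compact f hf Φ hΦ w) (husc.mono fun μ hμ => hμ.1)
  have hG : IsGreatest (h '' rotClass f Φ w) (h μ) :=
    ⟨⟨μ, hμ, rfl⟩, by rintro _ ⟨κ, hκ, rfl⟩; exact hmax hκ⟩
  rw [hG.csSup_eq]
  apply Subset.antisymm
  · intro y hy
    refine ⟨?_, hG.2 hy⟩
    obtain ⟨κ, hκ, rfl⟩ := hy
    exact h0 κ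
  · rintro y ⟨hy0, hy1⟩
    rcases (h0 μ).eq_or_lt with hz | hz
    · exact ⟨ν, hν, by linarith⟩
    · have hta : 0 ≤ y / h μ := div_nonneg hy0 hz.le
      have htb : y / h μ ≤ 1 := (div_le_one hz).2 hy1
      have htm : y / h μ * h μ = y := div_mul_cancel₀ _ hz.ne'
      generalize y / h μ = t at hta htb htm
      lift t to ℝ≥0 using hta
      have ht1 : t ≤ 1 := by exact_mod_cast htb
      obtain ⟨ξ, hξ, hξm, hξr⟩ := aux_mix f hf Φ hΦ μ ν hμ.1 hν.1 t ht1
      refine ⟨ξ, ⟨hξ, ?_⟩, ?_⟩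
      · rw [hξr, hμ.2, hν.2, ← add_smul]; simp
      · rw [haff μ hμ.1 ν hν.1 t ht1 ξ hξm, hν0, htm]; simp
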